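/- The map ι : ℕ^ℕ → 2^ℕ, p ↦ 1^{p(0)} 0 1^{p(1)} 0 1^{p(2)} 0 … (i.e. the binary sequence consisting of p(0) ones, then a zero, then p(1) ones, then a zero, and so on), is a topological embedding, and for every Borel set A ⊆ ℕ^ℕ the image ι(A) is a Borel subset of 2^ℕ with μ(ι(A)) = ν(A). -/

import Mathlib

open MeasureTheory ENNReal

/-- The cylinder `wℕ^ℕ` of all sequences in Baire space having the finite word `w` as a
prefix. -/
def baireCyl (w : List ℕ) : Set (ℕ → ℕ) :=
  {p | ∀ i : Fin w.length, p i = w.get i}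

/-- The cylinder of all binary sequences in Cantor space having the finite binary word `w`
as a prefix. -/
def cantorCyl (w : List Bool) : Set (ℕ → Bool) :=
  {p | ∀ i : Fin w.length, p i = w.get i}

open scoped Classical in
/-- The unary embedding `ι : ℕ^ℕ → 2^ℕ`, `p ↦ 1^{p(0)} 0 1^{p(1)} 0 1^{p(2)} 0 …`:
position `n` carries a `0` (i.e. `false`) exactly if `n + 1` is one of the cumulative sums
`Σ_{i≤k} (p(i)+1)`. -/
noncomputable def unaryEmb (p : ℕ → ℕ) : ℕ → Bool :=
  fun n => if ∀ k : ℕ, n + 1 ≠ ∑ i ∈ Finset.range (k + 1), (p i + 1) then true else false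

/-- The binary word `1^{w(0)} 0 1^{w(1)} 0 …` encoding a finite word `w`. -/
def unaryWord : List ℕ → List Bool
  | [] => []
  | n :: w => List.replicate n true ++ false :: unaryWord w

lemma unaryEmb_eq_false_iff (p : ℕ → ℕ) (n : ℕ) :
    unaryEmb p n = false ↔ ∃ k, n + 1 = ∑ i ∈ Finset.range (k + 1), (p i + 1) := by
  simp [unaryEmb]

lemma lt_sum_range_succ (p : ℕ → ℕ) (k : ℕ) :
    k < ∑ i ∈ Finset.range (k + 1), (p i + 1) := by
  rw [Finset.sum_add_distrib]
  simp
  omega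

lemma unaryEmb_congr {p p' : ℕ → ℕ} {n : ℕ} (h : ∀ i ≤ n, p i = p' i) :
    unaryEmb p n = unaryEmb p' n := by
  have key : ∀ {p p' : ℕ → ℕ}, (∀ i ≤ n, p i = p' i) →
      unaryEmb p n = false → unaryEmb p' n = false := by
    intro p p' h hp
    rw [unaryEmb_eq_false_iff] at hp ⊢
    obtain ⟨k, hk⟩ := hp
    have hlt := lt_sum_range_succ p k
    refine ⟨k, hk.trans (Finset.sum_congr rfl fun i hi => ?_)⟩
    rw [Finset.mem_range] at hi
    rw [h i (by omega)]
  rw [Bool.eq_iff_iff, ← not_iff_not, Bool.not_eq_true, Bool.not_eq_true]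
  exact ⟨key h, key fun i hi => (h i hi).symm⟩

lemma continuous_unaryEmb : Continuous unaryEmb := by
  refine continuous_pi fun n => ?_
  have hfac : (fun p => unaryEmb p n) =
      (fun f : Fin (n + 1) → ℕ =>
        unaryEmb (fun i => if h : i < n + 1 then f ⟨i, h⟩ else 0) n) ∘
      fun p i => p i := by
    funext p
    refine unaryEmb_congr fun i hi => ?_
    simp [Nat.lt_succ_of_le hi]
  rw [hfac]
  exact continuous_of_discreteTopology.comp (by fun_prop)

lemma unaryEmb_of_lt {p : ℕ → ℕ} {n : ℕ} (h : n < p 0) : unaryEmb p n = true := by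
  rw [← Bool.not_eq_false, unaryEmb_eq_false_iff]
  rintro ⟨k, hk⟩
  rw [Finset.sum_range_succ'] at hk
  omega

lemma unaryEmb_apply_zero (p : ℕ → ℕ) : unaryEmb p (p 0) = false := by
  rw [unaryEmb_eq_false_iff]
  exact ⟨0, by simp⟩

lemma unaryEmb_add (p : ℕ → ℕ) (m : ℕ) :
    unaryEmb p (p 0 + 1 + m) = unaryEmb (fun i => p (i + 1)) m := by
  rw [Bool.eq_iff_iff, ← not_iff_not, Bool.not_eq_true, Bool.not_eq_true,
    unaryEmb_eq_false_iff, unaryEmb_eq_false_iff]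
  constructor
  · rintro ⟨k, hk⟩
    rw [Finset.sum_range_succ'] at hk
    cases k with
    | zero =>
      simp only [zero_add, Finset.range_zero, Finset.sum_empty] at hk
      omega
    | succ k => exact ⟨k, by omega⟩
  · rintro ⟨k, hk⟩
    refine ⟨k + 1, ?_⟩
    rw [Finset.sum_range_succ']
    omega

lemma mem_baireCyl_cons {n : ℕ} {w : List ℕ} {p : ℕ → ℕ} :
    p ∈ baireCyl (n :: w) ↔ p 0 = n ∧ (fun i => p (i + 1)) ∈ baireCyl w :=
  Fin.forall_fin_succ

lemma mem_cantorCyl_cons {b : Bool} {w : List Bool} {q : ℕ → Bool} :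
    q ∈ cantorCyl (b :: w) ↔ q 0 = b ∧ (fun i => q (i + 1)) ∈ cantorCyl w :=
  Fin.forall_fin_succ

lemma mem_cantorCyl_replicate_append {n : ℕ} {b : Bool} {w : List Bool} {q : ℕ → Bool} :
    q ∈ cantorCyl (List.replicate n b ++ w) ↔
      (∀ i < n, q i = b) ∧ (fun i => q (n + i)) ∈ cantorCyl w := by
  induction n generalizing q with
  | zero => simp
  | succ n ih =>
    rw [List.replicate_succ, List.cons_append, mem_cantorCyl_cons, ih, Nat.forall_lt_succ_left',
      and_assoc]
    simp only [Nat.add_right_comm n 1]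

lemma unaryEmb_mem_cantorCyl_iff {w : List ℕ} {p : ℕ → ℕ} :
    unaryEmb p ∈ cantorCyl (unaryWord w) ↔ p ∈ baireCyl w := by
  induction w generalizing p with
  | nil => exact ⟨fun _ i => i.elim0, fun _ i => i.elim0⟩
  | cons n w ih =>
    rw [unaryWord, mem_cantorCyl_replicate_append, mem_cantorCyl_cons, mem_baireCyl_cons, ← ih]
    have hshift (h : p 0 = n) :
        (fun i => unaryEmb p (n + (i + 1))) = unaryEmb fun i => p (i + 1) := by
      funext i
      rw [← unaryEmb_add, h, add_assoc, add_comm 1 i]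
    constructor
    · rintro ⟨h₁, h₂, h₃⟩
      have h : p 0 = n := by
        refine le_antisymm (not_lt.1 fun hlt => ?_) (not_lt.1 fun hlt => ?_)
        · simp [unaryEmb_of_lt hlt] at h₂
        · simpa [unaryEmb_apply_zero] using h₁ _ hlt
      exact ⟨h, hshift h ▸ h₃⟩
    · rintro ⟨h, h₃⟩
      exact ⟨fun i hi => unaryEmb_of_lt (h ▸ hi), h ▸ unaryEmb_apply_zero p,
        (hshift h).symm ▸ h₃⟩

lemma inv_two_pow_length_unaryWord (w : List ℕ) :
    (2 : ℝ≥0∞)⁻¹ ^ (unaryWord w).length =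
      (w.map fun n => (2 : ℝ≥0∞)⁻¹ ^ (n + 1)).prod := by
  induction w with
  | nil => simp [unaryWord]
  | cons n w ih =>
    rw [List.map_cons, List.prod_cons, ← ih, ← pow_add, unaryWord]
    simp only [List.length_append, List.length_replicate, List.length_cons]
    ring

lemma baireCyl_ofFn (x : ℕ → ℕ) (n : ℕ) :
    baireCyl (List.ofFn fun i : Fin n => x i) = PiNat.cylinder x n := by
  ext p
  simp [baireCyl, PiNat.cylinder, Fin.forall_iff]

lemma cantorCyl_ofFn (x : ℕ → Bool) (n : ℕ) :
    cantorCyl (List.ofFn fun i : Fin n => x i) = PiNat.cylinder x n := by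
  ext p
  simp [cantorCyl, PiNat.cylinder, Fin.forall_iff]

lemma isOpen_cantorCyl (w : List Bool) : IsOpen (cantorCyl w) := by
  simp only [cantorCyl, Set.ofPred_forall]
  exact isOpen_iInter_of_finite fun i =>
    (isOpen_discrete {b | b = w.get i}).preimage
      (continuous_apply (A := fun _ : ℕ => Bool) (i : ℕ))

lemma preimage_unaryEmb_cantorCyl_unaryWord (w : List ℕ) :
    unaryEmb ⁻¹' cantorCyl (unaryWord w) = baireCyl w :=
  Set.ext fun _ => unaryEmb_mem_cantorCyl_iff

lemma isInducing_unaryEmb : Topology.IsInducing unaryEmb := by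
  refine Topology.isInducing_iff_nhds.2 fun x =>
    le_antisymm continuous_unaryEmb.continuousAt.le_comap fun s hs => ?_
  obtain ⟨_, ⟨y, n, rfl⟩, hx, hsub⟩ :=
    (PiNat.isTopologicalBasis_cylinders fun _ : ℕ => ℕ).mem_nhds_iff.1 hs
  rw [← baireCyl_ofFn, ← preimage_unaryEmb_cantorCyl_unaryWord] at hx hsub
  exact ⟨_, (isOpen_cantorCyl _).mem_nhds hx, hsub⟩

lemma isEmbedding_unaryEmb : Topology.IsEmbedding unaryEmb :=
  isInducing_unaryEmb.isEmbedding

lemma mem_range_unaryEmb {q : ℕ → Bool} (hq : {n | q n = false}.Infinite) :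
    q ∈ Set.range unaryEmb := by
  let a : ℕ → ℕ := Nat.nth fun n => q n = false
  have ha : StrictMono a := Nat.nth_strictMono hq
  let p : ℕ → ℕ := fun k => Nat.casesOn k (a 0) fun k => a (k + 1) - a k - 1
  have hsum (k : ℕ) : ∑ i ∈ Finset.range (k + 1), (p i + 1) = a k + 1 := by
    induction k with
    | zero => simp [p]
    | succ k ih =>
      have hlt : a k < a (k + 1) := ha k.lt_succ_self
      rw [Finset.sum_range_succ, ih]
      simp only [p]
      omega
  refine ⟨p, funext fun n => ?_⟩
  rw [Bool.eq_iff_iff, ← not_iff_not, Bool.not_eq_true, Bool.not_eq_true, unaryEmb_eq_false_iff]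
  simp only [hsum, Nat.add_right_cancel_iff]
  have hrange := Nat.range_nth_of_infinite hq
  exact ⟨fun ⟨k, hk⟩ => hk ▸ Nat.nth_mem_of_infinite hq k,
    fun hn => (hrange.ge hn).imp fun _ => Eq.symm⟩

lemma countable_compl_range_unaryEmb : (Set.range unaryEmb)ᶜ.Countable := by
  have hsub : (Set.range unaryEmb)ᶜ ⊆ ⋃ N : ℕ, {q | ∀ n, N ≤ n → q n = true} := by
    intro q hq
    have hfin : {n | q n = false}.Finite := Set.not_infinite.1 fun h => hq (mem_range_unaryEmb h)
    obtain ⟨N, hN⟩ := hfin.bddAbove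
    refine Set.mem_iUnion.2 ⟨N + 1, fun n hn => ?_⟩
    by_contra h
    have hle : n ≤ N := hN (by simpa using h)
    omega
  refine (Set.countable_iUnion fun N => ?_).mono hsub
  refine Set.MapsTo.countable_of_injOn (f := fun (q : ℕ → Bool) (i : Fin N) => q i)
    (Set.mapsTo_univ _ _) (fun q hq q' hq' h => funext fun n => ?_) Set.countable_univ
  by_cases hn : n < N
  · exact congrFun h ⟨n, hn⟩
  · rw [hq n (not_lt.1 hn), hq' n (not_lt.1 hn)]

lemma measure_singleton_eq_zero_of_cantorCyl {μ : Measure (ℕ → Bool)}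
    (hμ : ∀ w : List Bool, μ (cantorCyl w) = (2 : ℝ≥0∞)⁻¹ ^ w.length) (q : ℕ → Bool) :
    μ {q} = 0 := by
  refine le_antisymm (ge_of_tendsto'
    (ENNReal.tendsto_pow_atTop_nhds_zero_of_lt_one (r := 2⁻¹) (by simp)) fun n => ?_) zero_le
  have hn := hμ (List.ofFn fun i : Fin n => q i)
  rw [List.length_ofFn, cantorCyl_ofFn] at hn
  exact hn ▸ measure_mono (Set.singleton_subset_iff.2 (PiNat.self_mem_cylinder q n))

lemma isPiSystem_cylinders :
    IsPiSystem {s : Set (ℕ → ℕ) | ∃ x n, s = PiNat.cylinder x n} := by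
  rintro _ ⟨x, n, rfl⟩ _ ⟨y, m, rfl⟩ ⟨z, hx, hy⟩
  refine ⟨z, max n m, ?_⟩
  rw [← PiNat.mem_cylinder_iff_eq.1 hx, ← PiNat.mem_cylinder_iff_eq.1 hy]
  ext p
  simp only [Set.mem_inter_iff, PiNat.mem_cylinder_iff, lt_max_iff]
  grind

/-- The map `ι : ℕ^ℕ → 2^ℕ`, `p ↦ 1^{p(0)} 0 1^{p(1)} 0 …` is a topological embedding, and
for every Borel set `A ⊆ ℕ^ℕ` the image `ι(A)` is a Borel subset of `2^ℕ` with
`μ(ι(A)) = ν(A)`, where `ν` is the geometric product measure on Baire space and `μ` the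
fair-coin measure on Cantor space (both characterized by their values on cylinders). -/
theorem stmt9 (ν : Measure (ℕ → ℕ))
    (hν : ∀ w : List ℕ,
      ν (baireCyl w) = (w.map fun n => (2 : ℝ≥0∞)⁻¹ ^ (n + 1)).prod)
    (μ : Measure (ℕ → Bool))
    (hμ : ∀ w : List Bool, μ (cantorCyl w) = (2 : ℝ≥0∞)⁻¹ ^ w.length) :
    Topology.IsEmbedding unaryEmb ∧
      ∀ A : Set (ℕ → ℕ), MeasurableSet A →
        MeasurableSet (unaryEmb '' A) ∧ μ (unaryEmb '' A) = ν A := by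
  have hemb : MeasurableEmbedding unaryEmb :=
    continuous_unaryEmb.measurableEmbedding isEmbedding_unaryEmb.injective
  have : NullSingletonClass μ := ⟨measure_singleton_eq_zero_of_cantorCyl hμ⟩
  have hnull : μ (Set.range unaryEmb)ᶜ = 0 :=
    countable_compl_range_unaryEmb.measure_zero μ
  have hcyl (w : List ℕ) : μ.comap unaryEmb (baireCyl w) = ν (baireCyl w) := by
    rw [hemb.comap_apply, ← preimage_unaryEmb_cantorCyl_unaryWord,
      Set.image_preimage_eq_inter_range, measure_inter_conull hnull,
      preimage_unaryEmb_cantorCyl_unaryWord, hμ, hν, inv_two_pow_length_unaryWord]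
  have huniv : baireCyl [] = Set.univ := Set.eq_univ_of_forall fun _ i => i.elim0
  have : IsFiniteMeasure (μ.comap unaryEmb) := ⟨by rw [← huniv, hcyl, hν]; simp⟩
  have heq : μ.comap unaryEmb = ν := by
    refine ext_of_generate_finite _ ?_ isPiSystem_cylinders ?_ (huniv ▸ hcyl [])
    · exact (BorelSpace.measurable_eq (α := ℕ → ℕ)).trans
        (PiNat.isTopologicalBasis_cylinders fun _ : ℕ => ℕ).borel_eq_generateFrom
    · rintro _ ⟨x, n, rfl⟩
      rw [← baireCyl_ofFn]
      exact hcyl _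
  exact ⟨isEmbedding_unaryEmb, fun A hA =>
    ⟨hemb.measurableSet_image.2 hA, by rw [← hemb.comap_apply, heq]⟩⟩
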